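/- Let A be a finite alphabet and L a language over A. Then L belongs to L_1 = BC(L_{1/2}) (i.e., L is a finite boolean combination of sets ⟦w⟧) if and only if m^+(L) is finite (equivalently, L^+(k) = ∅ for some k). -/

import Mathlib

/-- `LPlus L m` is the set of words `v` reachable from some `w₀ ∈ L` by an
`m`-alternating word extension chain with respect to `L`:
`w₀ ⊑ w₁ ⊑ ⋯ ⊑ w_m ⊑ v`, `w₀ ∈ L`, and `wᵢ ∈ L ↔ w_{i+1} ∉ L` for `i < m`. -/
def LPlus {A : Type*} (L : Set (List A)) (m : ℕ) : Set (List A) :=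
  {v | ∃ c : ℕ → List A, c 0 ∈ L ∧ (∀ i < m, (c i).Sublist (c (i + 1))) ∧
    (c m).Sublist v ∧ ∀ i < m, (c i ∈ L ↔ c (i + 1) ∉ L)}

/-- `LMinus L m` is defined like `LPlus L m` but requiring `w₀ ∉ L`. -/
def LMinus {A : Type*} (L : Set (List A)) (m : ℕ) : Set (List A) :=
  {v | ∃ c : ℕ → List A, c 0 ∉ L ∧ (∀ i < m, (c i).Sublist (c (i + 1))) ∧
    (c m).Sublist v ∧ ∀ i < m, (c i ∈ L ↔ c (i + 1) ∉ L)}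

/-- The class `L_{1/2}`: finite unions of sets `⟦w⟧ = {v | w ⊑ v}`. -/
def LhalfClass (A : Type*) : Set (Set (List A)) :=
  {L | ∃ W : Finset (List A), L = ⋃ w ∈ W, {v : List A | w.Sublist v}}

/-- `m⁺(L) = sup {m | L⁺(m) ≠ ∅}`, taken in `ℕ∞ = ℕ ∪ {∞}`. -/
noncomputable def mPlus {A : Type*} (L : Set (List A)) : ℕ∞ :=
  ⨆ m ∈ {m : ℕ | (LPlus L m).Nonempty}, (m : ℕ∞)

/-- `m⁻(L) = sup {m | L⁻(m) ≠ ∅}`, taken in `ℕ∞ = ℕ ∪ {∞}`. -/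
noncomputable def mMinus {A : Type*} (L : Set (List A)) : ℕ∞ :=
  ⨆ m ∈ {m : ℕ | (LMinus L m).Nonempty}, (m : ℕ∞)

/-- The boolean closure of a class `C`: the smallest class containing `C`
and closed under finite union, finite intersection and complementation. -/
inductive BoolClosure {X : Type*} (C : Set (Set X)) : Set X → Prop
  | base : ∀ L ∈ C, BoolClosure C L
  | union : ∀ L M, BoolClosure C L → BoolClosure C M → BoolClosure C (L ∪ M)
  | inter : ∀ L M, BoolClosure C L → BoolClosure C M → BoolClosure C (L ∩ M)
  | compl : ∀ L, BoolClosure C L → BoolClosure C Lᶜ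

/-- **Higman's lemma** over a finite alphabet. -/
theorem wellQuasiOrdered_sublist {A : Type*} [Finite A] :
    WellQuasiOrdered (List.Sublist : List A → List A → Prop) := by
  have h : (Set.univ : Set A).PartiallyWellOrderedOn Eq :=
    Set.finite_univ.partiallyWellOrderedOn
  have h' := h.partiallyWellOrderedOn_sublistForall₂ (· = ·)
  intro f
  obtain ⟨m, n, hmn, hr⟩ := h' (fun n => ⟨f n, fun x _ => Set.mem_univ x⟩)
  obtain ⟨l, hl, hs⟩ := List.sublistForall₂_iff.1 hr
  rw [List.forall₂_eq_eq_eq] at hl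
  subst hl
  exact ⟨m, n, hmn, hs⟩

/-- A language closed under taking superwords is a finite union of sets `⟦w⟧`. -/
theorem mem_LhalfClass_of_upward_closed {A : Type*} [Finite A] {U : Set (List A)}
    (hU : ∀ v ∈ U, ∀ w, v.Sublist w → w ∈ U) : U ∈ LhalfClass A := by
  set M : Set (List A) := {v | v ∈ U ∧ ∀ w ∈ U, w.Sublist v → w = v}
  have hanti : IsAntichain List.Sublist M := fun v hv w hw hne hs => hne (hw.2 v hv.1 hs)
  have hfin : M.Finite := hanti.finite_of_wellQuasiOrdered wellQuasiOrdered_sublist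
  have hmin : ∀ n (v : List A), v.length = n → v ∈ U → ∃ w ∈ M, w.Sublist v := by
    intro n
    induction n using Nat.strong_induction_on with
    | _ n ih =>
      intro v hn hv
      by_cases hvM : v ∈ M
      · exact ⟨v, hvM, List.Sublist.refl v⟩
      · obtain ⟨w, hw, hs, hne⟩ : ∃ w ∈ U, w.Sublist v ∧ w ≠ v := by
          by_contra! hcon
          exact hvM ⟨hv, hcon⟩
        have hlt : w.length < n :=
          hn ▸ lt_of_le_of_ne hs.length_le fun he => hne (hs.eq_of_length he)
        obtain ⟨x, hx, hxs⟩ := ih _ hlt w rfl hw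
        exact ⟨x, hx, hxs.trans hs⟩
  refine ⟨hfin.toFinset, ?_⟩
  ext v
  simp only [Set.mem_iUnion, Set.Finite.mem_toFinset, Set.mem_ofPred_eq, exists_prop]
  exact ⟨fun hv => hmin _ v rfl hv, fun ⟨w, hw, hs⟩ => hU w hw.1 v hs⟩

theorem LPlus_upward_closed {A : Type*} {L : Set (List A)} {m : ℕ} :
    ∀ v ∈ LPlus L m, ∀ w, v.Sublist w → w ∈ LPlus L m :=
  fun _ ⟨c, h0, hs, hv, halt⟩ _ hw => ⟨c, h0, hs, hv.trans hw, halt⟩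

theorem LPlus_succ_subset {A : Type*} (L : Set (List A)) (m : ℕ) :
    LPlus L (m + 1) ⊆ LPlus L m :=
  fun _ ⟨c, h0, hs, hv, halt⟩ =>
    ⟨c, h0, fun i hi => hs i (by omega), (hs m (by omega)).trans hv, fun i hi => halt i (by omega)⟩

theorem alternating_mem_iff_even {A : Type*} {L : Set (List A)} {c : ℕ → List A} {m : ℕ}
    (h0 : c 0 ∈ L) (halt : ∀ i < m, (c i ∈ L ↔ c (i + 1) ∉ L)) :
    ∀ i ≤ m, (c i ∈ L ↔ Even i) := by
  intro i
  induction i with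
  | zero => simpa using h0
  | succ i ih =>
    intro hi
    have h1 := ih (by omega)
    have h2 := halt i (by omega)
    rw [Nat.even_add_one]
    tauto

theorem mem_iff_even_of_mem_LPlus {A : Type*} {L : Set (List A)} {m : ℕ} {v : List A}
    (hv : v ∈ LPlus L m) (hv' : v ∉ LPlus L (m + 1)) : v ∈ L ↔ Even m := by
  obtain ⟨c, h0, hs, hcv, halt⟩ := hv
  rw [← alternating_mem_iff_even h0 halt m le_rfl]
  by_contra hne
  refine hv' ⟨fun i => if i ≤ m then c i else v, by simpa using h0, ?_, by simp, ?_⟩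
  · intro i hi
    rcases (Nat.lt_succ_iff_lt_or_eq.1 hi) with h | rfl
    · simpa [h.le, Nat.succ_le_of_lt h] using hs i h
    · simpa using hcv
  · intro i hi
    rcases (Nat.lt_succ_iff_lt_or_eq.1 hi) with h | rfl
    · simpa [h.le, Nat.succ_le_of_lt h] using halt i h
    · simp
      tauto

theorem boolClosure_of_LPlus_eq_empty {A : Type*} [Finite A] {L : Set (List A)} {k : ℕ}
    (hk : LPlus L k = ∅) : BoolClosure (LhalfClass A) L := by
  have hup : ∀ m, BoolClosure (LhalfClass A) (LPlus L m) := fun m =>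
    .base _ (mem_LhalfClass_of_upward_closed LPlus_upward_closed)
  have hzero : L = L ∩ LPlus L 0 := by
    refine (Set.inter_eq_left.2 fun v hv => ?_).symm
    exact ⟨fun _ => v, hv, by simp, List.Sublist.refl v, by simp⟩
  rw [hzero]
  refine Nat.decreasingInduction (motive := fun m _ => BoolClosure (LhalfClass A) (L ∩ LPlus L m))
    (fun m _ ih => ?_) ?_ (Nat.zero_le k)
  · by_cases hm : Even m
    · have : L ∩ LPlus L m = (L ∩ LPlus L (m + 1)) ∪ (LPlus L m ∩ (LPlus L (m + 1))ᶜ) := by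
        ext v
        have h1 := @LPlus_succ_subset A L m v
        have h2 := @mem_iff_even_of_mem_LPlus A L m v
        simp only [Set.mem_inter_iff, Set.mem_union, Set.mem_compl_iff]
        tauto
      rw [this]
      exact .union _ _ ih (.inter _ _ (hup m) (.compl _ (hup (m + 1))))
    · have : L ∩ LPlus L m = L ∩ LPlus L (m + 1) := by
        ext v
        have h1 := @LPlus_succ_subset A L m v
        have h2 := @mem_iff_even_of_mem_LPlus A L m v
        simp only [Set.mem_inter_iff]
        tauto
      rwa [this]
  · rw [hk, Set.inter_empty, ← hk]
    exact hup k

/-- Along every chain of words, membership in a boolean combination of sets `⟦w⟧` changes a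
bounded number of times. -/
theorem BoolClosure.exists_encard_changes_le {A : Type*} {L : Set (List A)}
    (hL : BoolClosure (LhalfClass A) L) :
    ∃ N : ℕ, ∀ c : ℕ → List A, (∀ i, (c i).Sublist (c (i + 1))) →
      {i | ¬(c i ∈ L ↔ c (i + 1) ∈ L)}.encard ≤ N := by
  induction hL with
  | base L h =>
    obtain ⟨W, rfl⟩ := h
    refine ⟨1, fun c hc => ?_⟩
    have hmono : ∀ i j, i ≤ j → (c i).Sublist (c j) := by
      intro i j hij
      induction hij with
      | refl => exact List.Sublist.refl _
      | step _ ih => exact ih.trans (hc _)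
    set U : Set (List A) := ⋃ w ∈ W, {v : List A | w.Sublist v} with hU
    have hup : ∀ i j, i ≤ j → c i ∈ U → c j ∈ U := by
      intro i j hij hi
      simp only [hU, Set.mem_iUnion, Set.mem_ofPred_eq] at hi ⊢
      obtain ⟨w, hw, hs⟩ := hi
      exact ⟨w, hw, hs.trans (hmono i j hij)⟩
    rw [Nat.cast_one, Set.encard_le_one_iff]
    intro i j hi hj
    simp only [Set.mem_ofPred_eq] at hi hj
    have hi' := hup i (i + 1) (by omega)
    have hj' := hup j (j + 1) (by omega)
    rcases lt_trichotomy i j with h | h | h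
    · have := hup (i + 1) j h
      tauto
    · exact h
    · have := hup (j + 1) i h
      tauto
  | union L M _ _ ihL ihM | inter L M _ _ ihL ihM =>
    obtain ⟨N, hN⟩ := ihL
    obtain ⟨K, hK⟩ := ihM
    refine ⟨N + K, fun c hc => ?_⟩
    push_cast
    refine le_trans (Set.encard_le_encard fun i hi => ?_)
      ((Set.encard_union_le _ _).trans (add_le_add (hN c hc) (hK c hc)))
    simp only [Set.mem_ofPred_eq, Set.mem_union, Set.mem_inter_iff] at hi ⊢
    tauto
  | compl L _ ih =>
    obtain ⟨N, hN⟩ := ih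
    refine ⟨N, fun c hc => ?_⟩
    simpa only [Set.mem_compl_iff, not_iff_not] using hN c hc

/-- `L ∈ L₁ = BC(L_{1/2})` iff `m⁺(L)` is finite. -/
theorem stmt11 {A : Type*} [Fintype A] (L : Set (List A)) :
    BoolClosure (LhalfClass A) L ↔ mPlus L ≠ ⊤ := by
  constructor
  · intro hL
    obtain ⟨N, hN⟩ := hL.exists_encard_changes_le
    refine ne_top_of_le_ne_top (ENat.natCast_ne_top N) (iSup₂_le fun m hm => ?_)
    obtain ⟨v, c, h0, hs, -, halt⟩ := hm
    refine le_trans ?_ (hN (fun i => c (min i m)) fun i => ?_)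
    · have hcard : (m : ℕ∞) = (Finset.range m : Set ℕ).encard := by
        rw [Set.encard_coe_eq_coe_finsetCard, Finset.card_range]
      refine hcard.trans_le (Set.encard_le_encard fun i hi => ?_)
      have hi : i < m := by simpa using hi
      have := halt i hi
      simp only [Set.mem_ofPred_eq, min_eq_left hi.le, min_eq_left (Nat.succ_le_of_lt hi)]
      tauto
    · rcases lt_or_ge i m with hi | hi
      · simpa [min_eq_left hi.le, min_eq_left (Nat.succ_le_of_lt hi)] using hs i hi
      · simp [min_eq_right hi, min_eq_right (Nat.le_succ_of_le hi)]
  · intro h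
    by_contra hL
    refine h (ENat.eq_top_iff_forall_ge.2 fun m => ?_)
    exact le_iSup₂_of_le (f := fun (m : ℕ) (_ : m ∈ {m | (LPlus L m).Nonempty}) => (m : ℕ∞)) m
      (Set.nonempty_iff_ne_empty.2 fun he => hL (boolClosure_of_LPlus_eq_empty he)) le_rfl
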